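/- For all real numbers β, δ, the series z ↦ Σ_{j=1}^∞ C(z+j−1, j)·q^{2j} / ((1−q^{β−δ+2j+z})(1−q^{β+δ+2j+z})) (the j ≥ 1 tail of the series defining F_{β,δ}) converges for every z in the open half-plane {z ∈ ℂ : Re z > −β + |δ| − 2} and defines an analytic function there; in particular it is analytic on a neighborhood of z₀ = −β + |δ|. -/

import Mathlib

open Complex Real Filter Finset Topology

/-- For a positive real `a` and `w : ℂ`, `a^w := exp(w · ln a)`. -/
noncomputable def rcpow (a : ℝ) (w : ℂ) : ℂ := Complex.exp (w * (Real.log a : ℂ))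

/-- The generalized binomial coefficient `C(z+j-1, j) = (1/j!)·∏_{i=0}^{j-1}(z+i)`. -/
noncomputable def binomC (z : ℂ) (j : ℕ) : ℂ :=
  (∏ i ∈ Finset.range j, (z + (i : ℂ))) / (Nat.factorial j : ℂ)

/-- The `j`-th term of the series defining `F_{β,δ}(z)`. -/
noncomputable def Fterm (q β δ : ℝ) (z : ℂ) (j : ℕ) : ℂ :=
  binomC z j * (q : ℂ) ^ (2 * j) /
    ((1 - rcpow q (((β - δ + 2 * (j : ℝ)) : ℝ) + z)) *
     (1 - rcpow q (((β + δ + 2 * (j : ℝ)) : ℝ) + z)))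

lemma norm_rcpow {a : ℝ} (ha : 0 < a) (w : ℂ) : ‖rcpow a w‖ = a ^ w.re := by
  rw [rcpow, Complex.norm_exp, Complex.re_mul_ofReal, Real.rpow_def_of_pos ha, mul_comm]

lemma differentiable_rcpow_const_add (a : ℝ) (c : ℂ) :
    Differentiable ℂ (fun z => rcpow a (c + z)) := by
  unfold rcpow
  fun_prop

lemma differentiable_binomC (j : ℕ) : Differentiable ℂ (fun z => binomC z j) := by
  unfold binomC
  fun_prop

lemma norm_binomC_le {w : ℂ} {N : ℕ} (hw : ‖w‖ ≤ N + 1) (j : ℕ) :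
    ‖binomC w j‖ ≤ ((j + N).choose N : ℝ) := by
  have hfac : ((j + N).choose N : ℝ) =
      (∏ i ∈ Finset.range j, ((N : ℝ) + 1 + i)) / (Nat.factorial j : ℝ) := by
    rw [eq_div_iff (by positivity), add_comm j N, Nat.choose_symm_add]
    have h := Nat.ascFactorial_eq_factorial_mul_choose N j
    rw [Nat.ascFactorial_eq_prod_range] at h
    rw [mul_comm]
    exact_mod_cast h.symm
  rw [hfac, binomC, norm_div, norm_prod, Complex.norm_natCast]
  gcongr with i
  calc ‖w + (i : ℂ)‖ ≤ ‖w‖ + ‖(i : ℂ)‖ := norm_add_le _ _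
    _ ≤ N + 1 + i := by rw [Complex.norm_natCast]; gcongr

lemma one_sub_rpow_le_norm_one_sub_rcpow {q ε : ℝ} (hq0 : 0 < q) (hq1 : q < 1) {w : ℂ}
    (hw : ε ≤ w.re) : 1 - q ^ ε ≤ ‖1 - rcpow q w‖ := by
  have h := norm_sub_norm_le (1 : ℂ) (rcpow q w)
  rw [norm_one, norm_rcpow hq0] at h
  have := Real.rpow_le_rpow_of_exponent_ge hq0 hq1.le hw
  linarith

/-- On a bounded part of a half-plane, the tail terms are holomorphic and dominated by the terms of
a convergent series. -/
lemma exists_summable_bound_Fterm {q : ℝ} (hq0 : 0 < q) (hq1 : q < 1) {β δ c : ℝ}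
    (hc : -β + |δ| - 2 < c) (N : ℕ) :
    (∃ u : ℕ → ℝ, Summable u ∧ ∀ (j : ℕ) (w : ℂ), w ∈ {w : ℂ | c < w.re ∧ ‖w‖ < N + 1} →
      ‖Fterm q β δ w (j + 1)‖ ≤ u j) ∧
    ∀ j : ℕ, DifferentiableOn ℂ (fun w => Fterm q β δ w (j + 1))
      {w : ℂ | c < w.re ∧ ‖w‖ < N + 1} := by
  set ε : ℝ := β - |δ| + 2 + c with hε
  have hεpos : 0 < ε := by linarith
  have hpos : 0 < 1 - q ^ ε := sub_pos.2 (Real.rpow_lt_one hq0.le hq1 hεpos)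
  have hden : ∀ (s : ℝ), -|δ| ≤ s → ∀ (j : ℕ) (w : ℂ), c < w.re →
      1 - q ^ ε ≤ ‖1 - rcpow q (((β + s + 2 * ((j + 1 : ℕ) : ℝ) : ℝ) : ℂ) + w)‖ := by
    intro s hs j w hw
    apply one_sub_rpow_le_norm_one_sub_rcpow hq0 hq1
    rw [Complex.add_re, Complex.ofReal_re]
    push_cast
    have : (0 : ℝ) ≤ j := j.cast_nonneg
    linarith
  have hden₁ := hden (-δ) (neg_le_neg (le_abs_self δ))
  have hden₂ := hden δ (neg_abs_le δ)
  simp only [← sub_eq_add_neg] at hden₁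
  refine ⟨⟨fun j => ((j + 1 + N).choose N : ℝ) * (q ^ 2) ^ (j + 1) /
    ((1 - q ^ ε) * (1 - q ^ ε)), ?_, ?_⟩, ?_⟩
  · have hr : ‖q ^ 2‖ < 1 := by
      rw [Real.norm_of_nonneg (by positivity)]
      exact pow_lt_one₀ hq0.le hq1 two_ne_zero
    have h := summable_choose_mul_geometric_of_norm_lt_one N hr
    exact ((summable_nat_add_iff 1).2 h).div_const _
  · rintro j w ⟨hw, hwN⟩
    rw [Fterm, norm_div, norm_mul, norm_mul, norm_pow, Complex.norm_real,
      Real.norm_of_nonneg hq0.le, pow_mul]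
    beta_reduce
    gcongr
    · exact norm_binomC_le hwN.le _
    · exact hden₁ j w hw
    · exact hden₂ j w hw
  · rintro j
    unfold Fterm
    refine DifferentiableOn.div ?_ ?_ ?_
    · exact ((differentiable_binomC _).mul_const _).differentiableOn
    · exact (((differentiable_rcpow_const_add _ _).const_sub 1).mul
        ((differentiable_rcpow_const_add _ _).const_sub 1)).differentiableOn
    · rintro w ⟨hw, -⟩
      exact mul_ne_zero (norm_pos_iff.1 (hpos.trans_le (hden₁ j w hw)))
        (norm_pos_iff.1 (hpos.trans_le (hden₂ j w hw)))

theorem statement19 (q : ℝ) (hq0 : 0 < q) (hq1 : q < 1) (β δ : ℝ) :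
    (∀ z : ℂ, -β + |δ| - 2 < z.re → Summable (fun j : ℕ => Fterm q β δ z (j + 1))) ∧
    DifferentiableOn ℂ (fun z : ℂ => ∑' j : ℕ, Fterm q β δ z (j + 1))
      {z : ℂ | -β + |δ| - 2 < z.re} := by
  have key : ∀ z : ℂ, -β + |δ| - 2 < z.re →
      Summable (fun j : ℕ => Fterm q β δ z (j + 1)) ∧
      DifferentiableAt ℂ (fun z : ℂ => ∑' j : ℕ, Fterm q β δ z (j + 1)) z := by
    intro z hz
    obtain ⟨c, hc, hcz⟩ := exists_between hz
    obtain ⟨N, hN⟩ := exists_nat_gt ‖z‖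
    obtain ⟨⟨u, hu, hbound⟩, hdiff⟩ := exists_summable_bound_Fterm hq0 hq1 hc N
    have hzU : z ∈ {w : ℂ | c < w.re ∧ ‖w‖ < N + 1} := ⟨hcz, hN.trans (lt_add_one _)⟩
    have hU : IsOpen {w : ℂ | c < w.re ∧ ‖w‖ < N + 1} :=
      (isOpen_lt continuous_const Complex.continuous_re).inter
        (isOpen_lt continuous_norm continuous_const)
    exact ⟨hu.of_norm_bounded fun j => hbound j z hzU,
      (differentiableOn_tsum_of_summable_norm hu hdiff hU hbound).differentiableAt
        (hU.mem_nhds hzU)⟩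
  exact ⟨fun z hz => (key z hz).1, fun z hz => (key z hz).2.differentiableWithinAt⟩
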